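/- arXiv:0706.1765 — 2 statements merged into one kernel-verified Lean document; each statement's English description precedes it below -/
import Mathlib

section
/- With the resonator coefficients f = f_M as defined, for every ε > 0 one has Σ_{mn ≤ M} Λ(n) f(m) f(mn)/√n ≪_ε Q₂ (log M)^{1/2+ε} as M → ∞, where Λ is the von Mangoldt function and Q₂ = Π_p (1 + f(p)²). -/
open Filter Finset
open scoped Classical

/-- `L = √(log M · log log M)` for the resonator parameter `M`. -/
noncomputable def resL (M : ℕ) : ℝ := Real.sqrt (Real.log M * Real.log (Real.log M))

/-- The value of the resonator coefficients at a prime `p`: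
`f(p) = L/(√p log p)` if `L² ≤ p ≤ exp((log L)²)`, and `f(p) = 0` otherwise. -/
noncomputable def resFp (M p : ℕ) : ℝ :=
  if resL M ^ 2 ≤ (p : ℝ) ∧ (p : ℝ) ≤ Real.exp (Real.log (resL M) ^ 2) then
    resL M / (Real.sqrt p * Real.log p)
  else 0

/-- The resonator coefficients `f = f_M`: the multiplicative function supported on squarefree
integers determined by its values `resFp` at primes. -/
noncomputable def resF (M n : ℕ) : ℝ :=
  if Squarefree n then ∏ p ∈ n.primeFactors, resFp M p else 0

/-- `Q₁ = Π_p (1 + f(p)² + f(p)/√p)`. -/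
noncomputable def resQ1 (M : ℕ) : ℝ :=
  ∏ᶠ p ∈ {p : ℕ | p.Prime}, (1 + resFp M p ^ 2 + resFp M p / Real.sqrt p)

/-- `Q₂ = Π_p (1 + f(p)²)`. -/
noncomputable def resQ2 (M : ℕ) : ℝ :=
  ∏ᶠ p ∈ {p : ℕ | p.Prime}, (1 + resFp M p ^ 2)

/-- The multiplicative function `g` supported on squarefree integers with `g(p) = 1 + f(p)²`. -/
noncomputable def resG (M n : ℕ) : ℝ :=
  if Squarefree n then ∏ p ∈ n.primeFactors, (1 + resFp M p ^ 2) else 0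

theorem resL_nonneg (M : ℕ) : 0 ≤ resL M := Real.sqrt_nonneg _

theorem resFp_nonneg (M p : ℕ) : 0 ≤ resFp M p := by
  unfold resFp
  split_ifs
  · exact div_nonneg (resL_nonneg M) (mul_nonneg (Real.sqrt_nonneg _) (Real.log_natCast_nonneg p))
  · exact le_rfl

theorem resF_nonneg (M n : ℕ) : 0 ≤ resF M n := by
  unfold resF
  split_ifs
  · exact Finset.prod_nonneg fun p _ => resFp_nonneg M p
  · exact le_rfl

theorem resFp_eq_zero_of_floor_lt {M p : ℕ}
    (h : ⌊Real.exp (Real.log (resL M) ^ 2)⌋₊ < p) : resFp M p = 0 := by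
  unfold resFp
  rw [if_neg]
  rintro ⟨-, h2⟩
  exact absurd ((Nat.floor_lt (Real.exp_pos _).le).1 h) (not_lt.2 h2)

theorem resQ2_eq_prod {M N : ℕ} (hN : ⌊Real.exp (Real.log (resL M) ^ 2)⌋₊ ≤ N) :
    resQ2 M = ∏ p ∈ (Finset.Icc 1 N).filter Nat.Prime, (1 + resFp M p ^ 2) := by
  unfold resQ2
  apply finprod_mem_eq_prod_of_inter_mulSupport_eq
  ext p
  simp only [Set.mem_inter_iff, Set.mem_ofPred_eq, Function.mem_mulSupport, Finset.coe_filter,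
    Finset.mem_Icc]
  constructor
  · rintro ⟨hp, h⟩
    refine ⟨⟨⟨hp.one_le, ?_⟩, hp⟩, h⟩
    by_contra! hlt
    exact h (by rw [resFp_eq_zero_of_floor_lt (hN.trans_lt hlt)]; norm_num)
  · rintro ⟨⟨-, hp⟩, h⟩
    exact ⟨hp, h⟩

theorem resQ2_nonneg (M : ℕ) : 0 ≤ resQ2 M := by
  rw [resQ2_eq_prod le_rfl]
  exact Finset.prod_nonneg fun p _ => by positivity

/-- The Euler product dominates every truncation: `∑_{m ≤ K} f(m)² ≤ Q₂`. -/
theorem sum_resF_sq_le_resQ2 (M K : ℕ) :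
    ∑ m ∈ Finset.Icc 1 K, resF M m ^ 2 ≤ resQ2 M := by
  set N := max ⌊Real.exp (Real.log (resL M) ^ 2)⌋₊ K
  rw [resQ2_eq_prod (le_max_left _ K), Finset.prod_one_add]
  have h1 : ∑ m ∈ Finset.Icc 1 K, resF M m ^ 2 =
      ∑ m ∈ (Finset.Icc 1 K).filter Squarefree, ∏ p ∈ m.primeFactors, resFp M p ^ 2 := by
    rw [Finset.sum_filter]
    refine Finset.sum_congr rfl fun m _ => ?_
    unfold resF
    split_ifs
    · rw [Finset.prod_pow]
    · norm_num
  have hinj : Set.InjOn Nat.primeFactors ((Finset.Icc 1 K).filter Squarefree : Set ℕ) := by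
    intro a ha b hb hab
    simp only [Finset.coe_filter, Set.mem_ofPred_eq] at ha hb
    rw [← Nat.prod_primeFactors_of_squarefree ha.2, ← Nat.prod_primeFactors_of_squarefree hb.2, hab]
  rw [h1, ← Finset.sum_image (f := fun s => ∏ p ∈ s, resFp M p ^ 2) hinj]
  refine Finset.sum_le_sum_of_subset_of_nonneg ?_ fun s _ _ =>
    Finset.prod_nonneg fun p _ => sq_nonneg _
  intro s hs
  obtain ⟨m, hm, rfl⟩ := Finset.mem_image.1 hs
  simp only [Finset.mem_filter, Finset.mem_Icc] at hm
  refine Finset.mem_powerset.2 fun p hp => ?_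
  have hpp := Nat.prime_of_mem_primeFactors hp
  simp only [Finset.mem_filter, Finset.mem_Icc]
  exact ⟨⟨hpp.one_le, (Nat.le_of_mem_primeFactors hp).trans (hm.1.2.trans (le_max_right _ _))⟩, hpp⟩

theorem resF_mul_prime_le {M m p : ℕ} (hp : p.Prime) :
    resF M (m * p) ≤ resF M m * resFp M p := by
  by_cases h : Squarefree (m * p)
  · have hc : Nat.Coprime m p := Nat.coprime_of_squarefree_mul h
    unfold resF
    rw [if_pos h, if_pos (Squarefree.of_mul_left h), hc.primeFactors_mul,
      Finset.prod_union hc.disjoint_primeFactors, hp.primeFactors, Finset.prod_singleton]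
  · conv_lhs => rw [resF, if_neg h]
    exact mul_nonneg (resF_nonneg _ _) (resFp_nonneg _ _)

theorem log_mul_resFp_div_sqrt_le {M p : ℕ} (hp : p.Prime) :
    Real.log p * resFp M p / Real.sqrt p ≤
      if p ≤ ⌊Real.exp (Real.log (resL M) ^ 2)⌋₊ then resL M / p else 0 := by
  split_ifs with h
  · have hp0 : (0 : ℝ) < p := by exact_mod_cast hp.pos
    have hlog : 0 < Real.log p := Real.log_pos (by exact_mod_cast hp.one_lt)
    have hs : 0 < Real.sqrt p := Real.sqrt_pos.2 hp0
    unfold resFp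
    split_ifs
    · apply le_of_eq
      rw [show resL M / (p : ℝ) = resL M / (Real.sqrt p * Real.sqrt p) by
        rw [Real.mul_self_sqrt hp0.le]]
      field_simp
    · simpa using div_nonneg (resL_nonneg M) hp0.le
  · rw [resFp_eq_zero_of_floor_lt (not_le.1 h)]
    simp

theorem vonMangoldt_mul_resF_le (M n m : ℕ) :
    ArithmeticFunction.vonMangoldt n * resF M m * resF M (m * n) / Real.sqrt n ≤
      (if n ≤ ⌊Real.exp (Real.log (resL M) ^ 2)⌋₊ then resL M / n else 0) * resF M m ^ 2 := by
  by_cases hp : n.Prime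
  · rw [ArithmeticFunction.vonMangoldt_apply_prime hp]
    calc Real.log n * resF M m * resF M (m * n) / Real.sqrt n
        ≤ Real.log n * resF M m * (resF M m * resFp M n) / Real.sqrt n := by
          have := resF_nonneg M m
          have := Real.log_natCast_nonneg n
          gcongr
          exact resF_mul_prime_le hp
      _ = (Real.log n * resFp M n / Real.sqrt n) * resF M m ^ 2 := by ring
      _ ≤ _ := by
          gcongr
          exact log_mul_resFp_div_sqrt_le hp
  · have h0 : ArithmeticFunction.vonMangoldt n * resF M (m * n) = 0 := by
      by_cases hpp : IsPrimePow n
      · have hns : ¬ Squarefree (m * n) := fun h =>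
          hp ((Nat.squarefree_and_prime_pow_iff_prime).1 ⟨Squarefree.of_mul_right h, hpp⟩)
        rw [resF, if_neg hns, mul_zero]
      · rw [ArithmeticFunction.vonMangoldt_eq_zero_iff.2 hpp, zero_mul]
    rw [mul_right_comm, h0, zero_mul, zero_div]
    have := resL_nonneg M
    positivity

theorem sum_ite_resL_div_le (M : ℕ) :
    ∑ n ∈ Finset.Icc 1 M,
        (if n ≤ ⌊Real.exp (Real.log (resL M) ^ 2)⌋₊ then resL M / n else 0 : ℝ) ≤
      resL M * (1 + Real.log (resL M) ^ 2) := by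
  set E := ⌊Real.exp (Real.log (resL M) ^ 2)⌋₊ with hE
  have hL := resL_nonneg M
  have hE1 : 1 ≤ E := by
    rw [hE, Nat.one_le_floor_iff]
    exact Real.one_le_exp (sq_nonneg _)
  calc _ = ∑ n ∈ (Finset.Icc 1 M).filter (· ≤ E), resL M / n := (Finset.sum_filter _ _).symm
    _ ≤ ∑ n ∈ Finset.Icc 1 E, resL M / n := by
        refine Finset.sum_le_sum_of_subset_of_nonneg ?_ fun n _ _ => by positivity
        intro n hn
        simp only [Finset.mem_filter, Finset.mem_Icc] at hn ⊢
        exact ⟨hn.1.1, hn.2⟩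
    _ = resL M * (harmonic E : ℝ) := by
        rw [harmonic_eq_sum_Icc]
        push_cast
        rw [Finset.mul_sum]
        simp only [div_eq_mul_inv]
    _ ≤ resL M * (1 + Real.log E) := by
        gcongr
        exact harmonic_le_one_add_log E
    _ ≤ _ := by
        gcongr
        rw [Real.log_le_iff_le_exp (by exact_mod_cast hE1)]
        exact Nat.floor_le (Real.exp_pos _).le

theorem vonMangoldt_weighted_sum_le (M : ℕ) :
    ∑ n ∈ Finset.Icc 1 M, ∑ m ∈ Finset.Icc 1 (M / n),
        ArithmeticFunction.vonMangoldt n * resF M m * resF M (m * n) / Real.sqrt n ≤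
      resQ2 M * (resL M * (1 + Real.log (resL M) ^ 2)) := by
  have hL := resL_nonneg M
  calc _ ≤ ∑ n ∈ Finset.Icc 1 M,
        (if n ≤ ⌊Real.exp (Real.log (resL M) ^ 2)⌋₊ then resL M / n else 0 : ℝ) * resQ2 M := by
        refine Finset.sum_le_sum fun n _ => ?_
        refine (Finset.sum_le_sum fun m _ => vonMangoldt_mul_resF_le M n m).trans ?_
        rw [← Finset.mul_sum]
        exact mul_le_mul_of_nonneg_left (sum_resF_sq_le_resQ2 M _) (by positivity)
    _ ≤ _ := by
        rw [← Finset.sum_mul, mul_comm]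
        exact mul_le_mul_of_nonneg_left (sum_ite_resL_div_le M) (resQ2_nonneg M)

theorem eventually_resL_mul_le (ε : ℝ) (hε : 0 < ε) :
    ∀ᶠ M : ℕ in atTop,
      resL M * (1 + Real.log (resL M) ^ 2) ≤ 2 * Real.log M ^ ((1 : ℝ) / 2 + ε) := by
  have hlog : Tendsto (fun M : ℕ => Real.log M) atTop atTop :=
    Real.tendsto_log_atTop.comp tendsto_natCast_atTop_atTop
  have hx : ∀ᶠ x : ℝ in atTop, ‖Real.log x ^ (3 : ℝ)‖ ≤ 1 * ‖x ^ ε‖ :=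
    (isLittleO_log_rpow_rpow_atTop 3 hε).bound one_pos
  filter_upwards [hlog.eventually hx, (Real.tendsto_log_atTop.comp hlog).eventually_ge_atTop 1,
    hlog.eventually_ge_atTop 1] with M h3 hy hx1
  simp only [Function.comp] at hy
  unfold resL
  set x := Real.log M
  set y := Real.log x
  have hx0 : 0 < x := by linarith
  have hyx : y ≤ x := (Real.log_le_sub_one_of_pos hx0).trans (by linarith)
  have hlogL : Real.log (Real.sqrt (x * y)) ≤ y := by
    refine Real.log_le_log (by positivity) ?_
    exact Real.sqrt_le_iff.2 ⟨hx0.le, by nlinarith⟩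
  have hlogL0 : 0 ≤ Real.log (Real.sqrt (x * y)) :=
    Real.log_nonneg (Real.one_le_sqrt.2 (by nlinarith))
  have h3' : y ^ 3 ≤ x ^ ε := by
    rw [one_mul, Real.norm_of_nonneg (by positivity), Real.norm_of_nonneg (by positivity)] at h3
    exact_mod_cast h3
  have hsy : Real.sqrt y ≤ y := Real.sqrt_le_iff.2 ⟨by linarith, by nlinarith⟩
  calc Real.sqrt (x * y) * (1 + Real.log (Real.sqrt (x * y)) ^ 2)
      ≤ (Real.sqrt x * y) * (y ^ 2 + y ^ 2) := by
        rw [Real.sqrt_mul hx0.le] at hlogL hlogL0 ⊢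
        gcongr
        nlinarith
    _ = 2 * (Real.sqrt x * y ^ 3) := by ring
    _ ≤ 2 * (Real.sqrt x * x ^ ε) := by gcongr
    _ = 2 * x ^ ((1 : ℝ) / 2 + ε) := by rw [Real.rpow_add hx0, Real.sqrt_eq_rpow]

/-- With the resonator coefficients `f = f_M` as defined, for every `ε > 0`
one has `Σ_{mn ≤ M} Λ(n) f(m) f(mn)/√n ≪_ε Q₂ (log M)^{1/2+ε}` as `M → ∞`, where `Λ` is the
von Mangoldt function. -/
theorem resonator_vonMangoldt_weighted_sum (ε : ℝ) (hε : 0 < ε) :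
    (fun M : ℕ =>
        ∑ n ∈ Finset.Icc 1 M, ∑ m ∈ Finset.Icc 1 (M / n),
          ArithmeticFunction.vonMangoldt n * resF M m * resF M (m * n) / Real.sqrt n)
      =O[atTop] fun M : ℕ => resQ2 M * Real.log M ^ ((1 : ℝ) / 2 + ε) := by
  refine Asymptotics.IsBigO.of_bound 2 ?_
  filter_upwards [eventually_resL_mul_le ε hε] with M hM
  have hQ := resQ2_nonneg M
  have hlog := Real.log_natCast_nonneg M
  rw [Real.norm_of_nonneg, Real.norm_of_nonneg (by positivity)]
  · calc _ ≤ _ := vonMangoldt_weighted_sum_le M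
      _ ≤ resQ2 M * (2 * Real.log M ^ ((1 : ℝ) / 2 + ε)) := by gcongr
      _ = _ := by ring
  · refine Finset.sum_nonneg fun n _ => Finset.sum_nonneg fun m _ => ?_
    have := resF_nonneg M m
    have := resF_nonneg M (m * n)
    have := ArithmeticFunction.vonMangoldt_nonneg (n := n)
    positivity
end

section
/- Fix r ∈ ℕ. Then Σ_{nu ≤ M} τ_r(u) τ_r(nu)/(nu) = (C₀ (log M)^{r²+r}/(r²+r)!) (1 + o(1)) as M → ∞, where C₀ = Π_p (1 − 1/p)^{r²+r} Σ_{j≥0} τ_r(p^j) τ_{r+1}(p^j)/p^j. -/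
open Filter Finset

/-- `τ_r(n)`, the `r`-th divisor function: the number of ordered `r`-tuples of positive
integers whose product is `n`; equivalently the coefficient of `n^{-s}` in `ζ(s)^r`. -/
noncomputable def tauR (r n : ℕ) : ℕ := (ArithmeticFunction.zeta ^ r : ArithmeticFunction ℕ) n

/-- `C₀ = Π_p (1 − 1/p)^{r²+r} Σ_{j≥0} τ_r(p^j) τ_{r+1}(p^j)/p^j`. -/
noncomputable def constC0 (r : ℕ) : ℝ :=
  ∏' p : Nat.Primes,
    ((1 - 1 / ((p : ℕ) : ℝ)) ^ (r ^ 2 + r) *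
      ∑' j : ℕ, ((tauR r ((p : ℕ) ^ j) : ℝ) * tauR (r + 1) ((p : ℕ) ^ j)) / (p : ℕ) ^ j)

open scoped ArithmeticFunction.zeta ArithmeticFunction.Moebius

/-- The partial sum `∑_{m ≤ x} a(m)/m`. -/
noncomputable def reciprocalSum (a : ℕ → ℝ) (x : ℝ) : ℝ := ∑ m ∈ Icc 1 ⌊x⌋₊, a m / m

lemma sum_Icc_sum_Icc_div (F : ℕ → ℕ → ℝ) (N : ℕ) :
    ∑ n ∈ Icc 1 N, ∑ u ∈ Icc 1 (N / n), F n u =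
      ∑ m ∈ Icc 1 N, ∑ x ∈ m.divisorsAntidiagonal, F x.1 x.2 := by
  rw [Finset.sum_sigma', Finset.sum_sigma']
  refine Finset.sum_nbij' (fun y ↦ ⟨y.1 * y.2, (y.1, y.2)⟩) (fun y ↦ ⟨y.2.1, y.2.2⟩) ?_ ?_ ?_ ?_ ?_
  · rintro ⟨n, u⟩ h
    simp only [mem_sigma, mem_Icc, Nat.mem_divisorsAntidiagonal] at h ⊢
    obtain ⟨⟨h1, h2⟩, h3, h4⟩ := h
    rw [Nat.le_div_iff_mul_le (by lia)] at h4
    have : 0 < n * u := Nat.mul_pos (by lia) (by lia)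
    exact ⟨⟨this, by rwa [mul_comm]⟩, by simp, this.ne'⟩
  · rintro ⟨m, n, u⟩ h
    simp only [mem_sigma, mem_Icc, Nat.mem_divisorsAntidiagonal] at h ⊢
    obtain ⟨⟨h1, h2⟩, rfl, h4⟩ := h
    have hn : 0 < n := Nat.pos_of_ne_zero (left_ne_zero_of_mul h4)
    have hu : 0 < u := Nat.pos_of_ne_zero (right_ne_zero_of_mul h4)
    rw [Nat.le_div_iff_mul_le hn, mul_comm u n]
    exact ⟨⟨hn, by nlinarith⟩, hu, h2⟩
  · rintro ⟨n, u⟩ -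
    rfl
  · rintro ⟨m, n, u⟩ h
    simp only [mem_sigma, mem_Icc, Nat.mem_divisorsAntidiagonal] at h
    obtain ⟨-, rfl, -⟩ := h
    rfl
  · rintro ⟨n, u⟩ -
    rfl

lemma reciprocalSum_mul (a b : ArithmeticFunction ℝ) (x : ℝ) :
    reciprocalSum (a * b : ArithmeticFunction ℝ) x =
      ∑ d ∈ Icc 1 ⌊x⌋₊, a d / d * reciprocalSum b (x / d) := by
  simp only [reciprocalSum, Nat.floor_div_natCast, Finset.mul_sum]
  rw [sum_Icc_sum_Icc_div]
  refine Finset.sum_congr rfl fun m _ ↦ ?_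
  rw [ArithmeticFunction.mul_apply, Finset.sum_div]
  refine Finset.sum_congr rfl fun y hy ↦ ?_
  rw [← (Nat.mem_divisorsAntidiagonal.1 hy).1, Nat.cast_mul, mul_div_mul_comm]

lemma reciprocalSum_mono {a : ℕ → ℝ} (ha : ∀ n, 0 ≤ a n) : Monotone (reciprocalSum a) := by
  intro x y hxy
  refine Finset.sum_le_sum_of_subset_of_nonneg
    (Finset.Icc_subset_Icc_right (Nat.floor_le_floor hxy)) fun i _ _ ↦ ?_
  exact div_nonneg (ha i) (Nat.cast_nonneg i)

lemma natCast_tauR (r n : ℕ) : (tauR r n : ℝ) = ((ζ : ArithmeticFunction ℝ) ^ r) n := by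
  induction r generalizing n with
  | zero => simp [tauR, ArithmeticFunction.one_apply]
  | succ r ih =>
    simp only [tauR] at ih ⊢
    simp only [pow_succ, ArithmeticFunction.mul_apply, Nat.cast_sum, Nat.cast_mul, ih,
      ArithmeticFunction.natCoe_apply]

lemma tauR_succ_apply (r n : ℕ) : tauR (r + 1) n = ∑ x ∈ n.divisorsAntidiagonal, tauR r x.2 := by
  simp only [tauR]
  rw [pow_succ', ArithmeticFunction.mul_apply]
  refine Finset.sum_congr rfl fun x hx ↦ ?_
  have := Nat.mem_divisorsAntidiagonal.1 hx
  rw [ArithmeticFunction.zeta_apply_ne (left_ne_zero_of_mul (this.1 ▸ this.2)), one_mul]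

lemma pow_mul_sub_le_pow_sub_pow {a b : ℝ} (hb : 0 ≤ b) (hab : b ≤ a) (k : ℕ) :
    (k + 1) * b ^ k * (a - b) ≤ a ^ (k + 1) - b ^ (k + 1) := by
  induction k with
  | zero => simp
  | succ k ih =>
    have h1 : a * ((k + 1) * b ^ k * (a - b)) ≤ a * (a ^ (k + 1) - b ^ (k + 1)) :=
      mul_le_mul_of_nonneg_left ih (hb.trans hab)
    have h2 : b * ((k + 1) * b ^ k * (a - b)) ≤ a * ((k + 1) * b ^ k * (a - b)) :=
      mul_le_mul_of_nonneg_right hab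
        (mul_nonneg (by positivity) (sub_nonneg.2 hab))
    push_cast
    ring_nf at h1 h2 ⊢
    linarith

lemma pow_sub_pow_le_mul_pow {a b : ℝ} (hb : 0 ≤ b) (hab : b ≤ a) (k : ℕ) :
    a ^ (k + 1) - b ^ (k + 1) ≤ (k + 1) * a ^ k * (a - b) := by
  have h := (le_abs_self _).trans (abs_pow_sub_pow_le (a := a) (b := b) (n := k + 1))
  rw [abs_of_nonneg (sub_nonneg.2 hab), abs_of_nonneg hb, abs_of_nonneg (hb.trans hab),
    max_eq_left hab] at h
  push_cast at h
  linarith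

lemma log_div_natCast_sub (x : ℝ) (hx : 0 < x) (n : ℕ) :
    1 / ((n : ℝ) + 2) ≤ Real.log (x / (n + 1)) - Real.log (x / (n + 2)) ∧
      Real.log (x / (n + 1)) - Real.log (x / (n + 2)) ≤ 1 / ((n : ℝ) + 1) := by
  have h1 : (0 : ℝ) < n + 1 := by positivity
  have h2 : (0 : ℝ) < n + 2 := by positivity
  have h : Real.log (x / (n + 1)) - Real.log (x / (n + 2)) = Real.log ((n + 2) / (n + 1)) := by
    rw [Real.log_div hx.ne' h1.ne', Real.log_div hx.ne' h2.ne', Real.log_div h2.ne' h1.ne']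
    ring
  rw [h]
  constructor
  · refine le_trans (le_of_eq ?_) (Real.one_sub_inv_le_log_of_pos (div_pos h2 h1))
    field_simp
    ring
  · refine (Real.log_le_sub_one_of_pos (div_pos h2 h1)).trans (le_of_eq ?_)
    field_simp
    ring

lemma sum_log_pow_telescope (k : ℕ) {x : ℝ} (N : ℕ) (hN : (N : ℝ) + 1 ≤ x) :
    (k + 1) * ∑ i ∈ range N, 1 / ((i : ℝ) + 2) * Real.log (x / (i + 2)) ^ k ≤
        Real.log x ^ (k + 1) - Real.log (x / (N + 1)) ^ (k + 1) ∧
      Real.log x ^ (k + 1) - Real.log (x / (N + 1)) ^ (k + 1) ≤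
        (k + 1) * ∑ i ∈ range N, 1 / ((i : ℝ) + 1) * Real.log (x / (i + 1)) ^ k := by
  induction N with
  | zero => simp
  | succ N ih =>
    push_cast at hN
    obtain ⟨ih1, ih2⟩ := ih (by linarith)
    have hx : 0 < x := lt_of_lt_of_le (by positivity) hN
    obtain ⟨h1, h2⟩ := log_div_natCast_sub x hx N
    have e : ((N + 1 : ℕ) : ℝ) + 1 = N + 2 := by push_cast; ring
    rw [e, Finset.sum_range_succ, Finset.sum_range_succ]
    have hb : 0 ≤ Real.log (x / (N + 2)) :=
      Real.log_nonneg (by rw [le_div_iff₀ (by positivity)]; linarith)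
    have hab : Real.log (x / (N + 2)) ≤ Real.log (x / (N + 1)) := by
      have : (0 : ℝ) < 1 / (N + 2) := by positivity
      linarith
    have l := pow_mul_sub_le_pow_sub_pow hb hab k
    have u := pow_sub_pow_le_mul_pow hb hab k
    have l' := mul_le_mul_of_nonneg_left h1
      (show 0 ≤ (k + 1) * Real.log (x / (N + 2)) ^ k by positivity)
    have u' := mul_le_mul_of_nonneg_left h2
      (show 0 ≤ (k + 1) * Real.log (x / (N + 1)) ^ k by
        have := hb.trans hab
        positivity)
    constructor <;> linarith

lemma abs_sum_log_pow_sub_le (k : ℕ) {x : ℝ} (hx : 1 ≤ x) :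
    |∑ d ∈ Icc 1 ⌊x⌋₊, 1 / (d : ℝ) * Real.log (x / d) ^ k - Real.log x ^ (k + 1) / (k + 1)| ≤
      (1 + Real.log x) ^ k := by
  have hx0 : 0 < x := by linarith
  obtain ⟨N, hN⟩ : ∃ N, ⌊x⌋₊ = N + 1 :=
    Nat.exists_eq_succ_of_ne_zero (Nat.floor_pos.2 hx).ne'
  have hNx : (N : ℝ) + 1 ≤ x := by
    have := Nat.floor_le hx0.le
    rw [hN] at this
    exact_mod_cast this
  have hxN : x ≤ 2 * ((N : ℝ) + 1) := by
    have := Nat.lt_floor_add_one x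
    rw [hN] at this
    push_cast at this
    have : (0 : ℝ) ≤ N := by positivity
    linarith
  obtain ⟨h1, h2⟩ := sum_log_pow_telescope k N hNx
  have e : ∑ d ∈ Icc 1 ⌊x⌋₊, 1 / (d : ℝ) * Real.log (x / d) ^ k =
      ∑ i ∈ range (N + 1), 1 / ((i : ℝ) + 1) * Real.log (x / (i + 1)) ^ k := by
    rw [hN, Finset.range_eq_Ico, Finset.sum_Ico_eq_sum_range, ← Finset.Ico_add_one_right_eq_Icc,
      Finset.sum_Ico_eq_sum_range]
    simp [add_comm]
  have hlog : 0 ≤ Real.log x := Real.log_nonneg hx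
  have hlast : 0 ≤ Real.log (x / (N + 1)) :=
    Real.log_nonneg (by rw [le_div_iff₀ (by positivity)]; linarith)
  have hlast' : Real.log (x / (N + 1)) ≤ 1 := by
    refine (Real.log_le_sub_one_of_pos (by positivity)).trans ?_
    have : x / (N + 1) ≤ 2 := by rw [div_le_iff₀ (by positivity)]; exact hxN
    linarith
  have hpow : Real.log (x / (N + 1)) ^ (k + 1) ≤ 1 := pow_le_one₀ hlast hlast'
  have hone : 1 ≤ (1 + Real.log x) ^ k := one_le_pow₀ (by linarith)
  have hlogk : Real.log x ^ k ≤ (1 + Real.log x) ^ k := pow_le_pow_left₀ hlog (by linarith) k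
  have hk : (0 : ℝ) < k + 1 := by positivity
  have hk1 : (1 : ℝ) ≤ k + 1 := by linarith [(Nat.cast_nonneg k : (0 : ℝ) ≤ k)]
  rw [e, abs_le]
  constructor
  · rw [Finset.sum_range_succ]
    have h0 : 0 ≤ 1 / ((N : ℝ) + 1) * Real.log (x / (N + 1)) ^ k := by positivity
    have h3 : Real.log x ^ (k + 1) / (k + 1) ≤
        ∑ i ∈ range N, 1 / ((i : ℝ) + 1) * Real.log (x / (i + 1)) ^ k + 1 := by
      rw [div_le_iff₀ hk]
      linarith
    linarith
  · rw [Finset.sum_range_succ']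
    have h3 : ∑ i ∈ range N, 1 / ((i : ℝ) + 2) * Real.log (x / (i + 2)) ^ k ≤
        Real.log x ^ (k + 1) / (k + 1) := by
      rw [le_div_iff₀ hk]
      have : 0 ≤ Real.log (x / (N + 1)) ^ (k + 1) := by positivity
      linarith
    have h4 : ∑ i ∈ range N, 1 / (((i + 1 : ℕ) : ℝ) + 1) * Real.log (x / ((i + 1 : ℕ) + 1)) ^ k =
        ∑ i ∈ range N, 1 / ((i : ℝ) + 2) * Real.log (x / (i + 2)) ^ k := by
      refine Finset.sum_congr rfl fun i _ ↦ ?_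
      push_cast
      ring_nf
    rw [h4]
    simp only [Nat.cast_zero, zero_add, div_one, one_mul]
    linarith

lemma reciprocalSum_tauR_succ (k : ℕ) (x : ℝ) :
    reciprocalSum (fun n ↦ (tauR (k + 1) n : ℝ)) x =
      ∑ d ∈ Icc 1 ⌊x⌋₊, 1 / (d : ℝ) * reciprocalSum (fun n ↦ (tauR k n : ℝ)) (x / d) := by
  simp only [natCast_tauR]
  rw [pow_succ', reciprocalSum_mul]
  refine Finset.sum_congr rfl fun d hd ↦ ?_
  have : d ≠ 0 := by have := (mem_Icc.1 hd).1; lia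
  simp [this]

lemma exists_abs_reciprocalSum_tauR_sub_le (k : ℕ) : ∃ C : ℝ, 0 ≤ C ∧ ∀ x : ℝ, 1 ≤ x →
    |reciprocalSum (fun n ↦ (tauR (k + 1) n : ℝ)) x - Real.log x ^ (k + 1) / (k + 1).factorial| ≤
      C * (1 + Real.log x) ^ k := by
  induction k with
  | zero =>
    refine ⟨1, zero_le_one, fun x hx ↦ ?_⟩
    have h := abs_sum_log_pow_sub_le 0 hx
    rw [reciprocalSum_tauR_succ]
    have e : ∑ d ∈ Icc 1 ⌊x⌋₊, 1 / (d : ℝ) * reciprocalSum (fun n ↦ (tauR 0 n : ℝ)) (x / d) =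
        ∑ d ∈ Icc 1 ⌊x⌋₊, 1 / (d : ℝ) * Real.log (x / d) ^ 0 := by
      refine Finset.sum_congr rfl fun d hd ↦ ?_
      have hd := mem_Icc.1 hd
      have hfl : 1 ≤ ⌊x / d⌋₊ := by
        rw [Nat.floor_div_natCast, Nat.le_div_iff_mul_le (by lia), one_mul]
        exact hd.2
      congr 1
      rw [reciprocalSum, Finset.sum_eq_single_of_mem 1 (by simpa using hfl)]
      · simp [tauR]
      · intro b _ hb
        simp [tauR, hb]
    rw [e]
    simpa using h
  | succ k ih =>
    obtain ⟨C, hC, ih⟩ := ih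
    refine ⟨2 * C + 1, by linarith, fun x hx ↦ ?_⟩
    have hlog : 0 ≤ Real.log x := Real.log_nonneg hx
    have hfac : (1 : ℝ) ≤ ((k + 1).factorial : ℝ) := by exact_mod_cast Nat.factorial_pos _
    have hA := abs_sum_log_pow_sub_le (k + 1) hx
    have hH := abs_sum_log_pow_sub_le 0 hx
    simp only [pow_zero, mul_one, Nat.cast_zero, zero_add, pow_one, div_one] at hH
    have hH' : ∑ d ∈ Icc 1 ⌊x⌋₊, 1 / (d : ℝ) ≤ 2 * (1 + Real.log x) := by
      have := (abs_le.1 hH).2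
      linarith
    set A := ∑ d ∈ Icc 1 ⌊x⌋₊, 1 / (d : ℝ) * Real.log (x / d) ^ (k + 1) with hAdef
    have e1 : |reciprocalSum (fun n ↦ (tauR (k + 1 + 1) n : ℝ)) x - A / (k + 1).factorial| ≤
        2 * C * (1 + Real.log x) ^ (k + 1) := by
      rw [reciprocalSum_tauR_succ, hAdef, Finset.sum_div, ← Finset.sum_sub_distrib]
      calc _ ≤ ∑ d ∈ Icc 1 ⌊x⌋₊, 1 / (d : ℝ) * (C * (1 + Real.log x) ^ k) := by
            refine (Finset.abs_sum_le_sum_abs _ _).trans (Finset.sum_le_sum fun d hd ↦ ?_)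
            have hd := mem_Icc.1 hd
            have hd0 : (1 : ℝ) ≤ d := by exact_mod_cast hd.1
            have hdx : (d : ℝ) ≤ x := (Nat.le_floor_iff (by linarith)).1 hd.2
            have h1 : 1 ≤ x / d := by rw [le_div_iff₀ (by linarith)]; linarith
            have h2 : Real.log (x / d) ≤ Real.log x :=
              Real.log_le_log (by linarith) (div_le_self (by linarith) hd0)
            have h3 : 0 ≤ Real.log (x / d) := Real.log_nonneg h1
            rw [mul_div_assoc, ← mul_sub, abs_mul, abs_of_nonneg (by positivity)]
            refine mul_le_mul_of_nonneg_left ((ih _ h1).trans ?_) (by positivity)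
            gcongr
        _ = (∑ d ∈ Icc 1 ⌊x⌋₊, 1 / (d : ℝ)) * (C * (1 + Real.log x) ^ k) := by
            rw [Finset.sum_mul]
        _ ≤ 2 * (1 + Real.log x) * (C * (1 + Real.log x) ^ k) := by gcongr
        _ = _ := by ring
    have e2 : |A / (k + 1).factorial - Real.log x ^ (k + 1 + 1) / (k + 1 + 1).factorial| ≤
        (1 + Real.log x) ^ (k + 1) := by
      have : A / (k + 1).factorial - Real.log x ^ (k + 1 + 1) / (k + 1 + 1).factorial =
          (A - Real.log x ^ (k + 1 + 1) / ((k + 1 : ℕ) + 1)) / (k + 1).factorial := by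
        rw [Nat.factorial_succ (k + 1)]
        push_cast
        field_simp
      rw [this, abs_div, abs_of_pos (by linarith : (0 : ℝ) < ((k + 1).factorial : ℝ))]
      exact (div_le_self (abs_nonneg _) hfac).trans hA
    calc _ ≤ _ := abs_sub_le _ (A / (k + 1).factorial) _
      _ ≤ _ := add_le_add e1 e2
      _ = _ := by ring

lemma tendsto_reciprocalSum_tauR_div (k : ℕ) :
    Tendsto (fun x : ℝ ↦ reciprocalSum (fun n ↦ (tauR (k + 1) n : ℝ)) x / Real.log x ^ (k + 1))
      atTop (nhds (1 / (k + 1).factorial)) := by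
  obtain ⟨C, hC, h⟩ := exists_abs_reciprocalSum_tauR_sub_le k
  rw [tendsto_iff_norm_sub_tendsto_zero]
  have hlim : Tendsto (fun x : ℝ ↦ C * 2 ^ k / Real.log x) atTop (nhds 0) :=
    tendsto_const_nhds.div_atTop Real.tendsto_log_atTop
  refine squeeze_zero' (.of_forall fun x ↦ norm_nonneg _) ?_ hlim
  filter_upwards [eventually_ge_atTop 1, Real.tendsto_log_atTop.eventually_ge_atTop 1]
    with x hx hlog
  have hl : 0 < Real.log x := by linarith
  rw [show reciprocalSum (fun n ↦ (tauR (k + 1) n : ℝ)) x / Real.log x ^ (k + 1) -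
      1 / (k + 1).factorial = (reciprocalSum (fun n ↦ (tauR (k + 1) n : ℝ)) x -
        Real.log x ^ (k + 1) / (k + 1).factorial) / Real.log x ^ (k + 1) by
      field_simp, Real.norm_eq_abs, abs_div, abs_of_pos (pow_pos hl _),
    div_le_div_iff₀ (by positivity) hl]
  calc _ ≤ C * (1 + Real.log x) ^ k * Real.log x := by gcongr; exact h x hx
    _ ≤ C * (2 * Real.log x) ^ k * Real.log x := by gcongr; linarith
    _ = _ := by ring

lemma tendsto_reciprocalSum_mul_zeta_pow {g : ArithmeticFunction ℝ}
    (hg : Summable fun n : ℕ ↦ |g n / n|) (k : ℕ) :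
    Tendsto (fun M : ℕ ↦
        reciprocalSum (g * (ζ : ArithmeticFunction ℝ) ^ (k + 1) : ArithmeticFunction ℝ) M /
          Real.log M ^ (k + 1))
      atTop (nhds ((∑' n : ℕ, g n / n) * (1 / (k + 1).factorial))) := by
  set T : ℝ → ℝ := reciprocalSum (fun n ↦ (tauR (k + 1) n : ℝ)) with hT
  have hTmono : Monotone T := reciprocalSum_mono fun n ↦ Nat.cast_nonneg _
  have hTzero : ∀ y, y < 1 → T y = 0 := fun y hy ↦ by
    simp [hT, reciprocalSum, Nat.floor_eq_zero.2 hy]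
  have hTnonneg : ∀ y, 0 ≤ T y := fun y ↦ by
    rw [← hTzero (min y 0) (by linarith [min_le_right y 0])]
    exact hTmono (min_le_left _ _)
  have hTlim := tendsto_reciprocalSum_tauR_div k
  have hcast : Tendsto (fun M : ℕ ↦ (M : ℝ)) atTop atTop := tendsto_natCast_atTop_atTop
  have hexpand : ∀ M : ℕ,
      reciprocalSum (g * (ζ : ArithmeticFunction ℝ) ^ (k + 1) : ArithmeticFunction ℝ) M /
          Real.log M ^ (k + 1) = ∑' d : ℕ, g d / d * (T (M / d) / Real.log M ^ (k + 1)) := by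
    intro M
    rw [reciprocalSum_mul, Finset.sum_div, tsum_eq_sum (s := Icc 1 ⌊(M : ℝ)⌋₊)]
    · refine Finset.sum_congr rfl fun d _ ↦ ?_
      rw [mul_div_assoc, hT]
      simp only [natCast_tauR]
    · intro d hd
      rcases Nat.eq_zero_or_pos d with rfl | hd0
      · simp
      · have : M < d := by
          rw [Nat.floor_natCast, mem_Icc] at hd
          lia
        have hd1 : (0 : ℝ) < d := by exact_mod_cast hd0
        rw [hTzero _ (by rw [div_lt_one hd1]; exact_mod_cast this)]
        simp
  simp_rw [hexpand]
  rw [← tsum_mul_right]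
  obtain ⟨B, hB⟩ : ∃ B : ℝ, ∀ᶠ M : ℕ in atTop, T M / Real.log M ^ (k + 1) ≤ B :=
    ⟨_, (hTlim.comp hcast).eventually_le_const (lt_add_one _)⟩
  refine tendsto_tsum_of_dominated_convergence (bound := fun d ↦ |g d / d| * B)
    (hg.mul_right B) (fun d ↦ ?_) ?_
  · rcases Nat.eq_zero_or_pos d with rfl | hd0
    · simp
    refine Tendsto.const_mul _ ?_
    have hd1 : (0 : ℝ) < d := by exact_mod_cast hd0
    have hdiv : Tendsto (fun M : ℕ ↦ (M : ℝ) / d) atTop atTop := hcast.atTop_div_const hd1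
    have hratio : Tendsto (fun M : ℕ ↦ (Real.log (M / d) / Real.log M) ^ (k + 1)) atTop
        (nhds 1) := by
      have h0 : Tendsto (fun M : ℕ ↦ 1 - Real.log d / Real.log M) atTop (nhds (1 - 0)) :=
        tendsto_const_nhds.sub
          (tendsto_const_nhds.div_atTop (Real.tendsto_log_atTop.comp hcast))
      rw [sub_zero] at h0
      have h1 := h0.pow (k + 1)
      rw [one_pow] at h1
      refine h1.congr' ?_
      filter_upwards [(Real.tendsto_log_atTop.comp hcast).eventually_gt_atTop 0,
        eventually_gt_atTop 0] with M hM hM0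
      have hM0' : (M : ℝ) ≠ 0 := by exact_mod_cast hM0.ne'
      simp only [Function.comp] at hM
      rw [Real.log_div hM0' hd1.ne', sub_div, div_self hM.ne']
    have := (hTlim.comp hdiv).mul hratio
    rw [mul_one] at this
    refine this.congr' ?_
    filter_upwards [(Real.tendsto_log_atTop.comp hdiv).eventually_gt_atTop 0] with M hM
    simp only [Function.comp] at hM ⊢
    rw [div_pow, div_mul_div_cancel₀ (pow_pos hM _).ne']
  · filter_upwards [hB, (Real.tendsto_log_atTop.comp hcast).eventually_gt_atTop 0] with M hM hlog d
    simp only [Function.comp] at hlog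
    rw [norm_mul, Real.norm_eq_abs]
    refine mul_le_mul_of_nonneg_left ?_ (abs_nonneg _)
    rw [Real.norm_of_nonneg (div_nonneg (hTnonneg _) (by positivity))]
    refine le_trans ?_ hM
    gcongr
    refine hTmono ?_
    rcases Nat.eq_zero_or_pos d with rfl | hd0
    · simp
    · exact div_le_self (Nat.cast_nonneg _) (by exact_mod_cast hd0)

lemma mul_apply_prime_pow (a b : ArithmeticFunction ℝ) {p : ℕ} (hp : p.Prime) (j : ℕ) :
    (a * b) (p ^ j) = ∑ x ∈ antidiagonal j, a (p ^ x.1) * b (p ^ x.2) := by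
  rw [ArithmeticFunction.mul_apply, Nat.sum_divisorsAntidiagonal (fun x y ↦ a x * b y),
    Nat.sum_divisors_prime_pow hp,
    Finset.Nat.sum_antidiagonal_eq_sum_range_succ (fun x y ↦ a (p ^ x) * b (p ^ y))]
  refine Finset.sum_congr rfl fun i hi ↦ ?_
  rw [Nat.pow_div (by have := mem_range.1 hi; lia) hp.pos]

lemma abs_mul_apply_prime_pow_le {a b : ArithmeticFunction ℝ} {p : ℕ} (hp : p.Prime) {A B : ℕ}
    (ha : ∀ j : ℕ, |a (p ^ j)| ≤ ((j : ℝ) + 1) ^ A) (hb : ∀ j : ℕ, |b (p ^ j)| ≤ ((j : ℝ) + 1) ^ B)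
    (j : ℕ) : |(a * b) (p ^ j)| ≤ ((j : ℝ) + 1) ^ (A + B + 1) := by
  rw [mul_apply_prime_pow a b hp]
  calc _ ≤ ∑ x ∈ antidiagonal j, ((j : ℝ) + 1) ^ (A + B) := by
        refine (Finset.abs_sum_le_sum_abs _ _).trans (Finset.sum_le_sum fun x hx ↦ ?_)
        have hx := mem_antidiagonal.1 hx
        have h1 : (x.1 : ℝ) ≤ j := by exact_mod_cast (by lia : x.1 ≤ j)
        have h2 : (x.2 : ℝ) ≤ j := by exact_mod_cast (by lia : x.2 ≤ j)
        rw [abs_mul, pow_add]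
        refine mul_le_mul ((ha _).trans ?_) ((hb _).trans ?_) (abs_nonneg _) (by positivity) <;>
          gcongr
    _ = _ := by
        rw [Finset.sum_const, Finset.Nat.card_antidiagonal, nsmul_eq_mul]
        push_cast
        ring

lemma abs_pow_apply_prime_pow_le {a : ArithmeticFunction ℝ} {p : ℕ} (hp : p.Prime)
    (ha : ∀ j, |a (p ^ j)| ≤ 1) (k j : ℕ) : |(a ^ k) (p ^ j)| ≤ ((j : ℝ) + 1) ^ k := by
  induction k generalizing j with
  | zero =>
    rw [pow_zero, pow_zero, ArithmeticFunction.one_apply]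
    split_ifs <;> simp
  | succ k ih =>
    rw [pow_succ]
    simpa using abs_mul_apply_prime_pow_le (B := 0) hp ih (by simpa using ha) j

lemma mul_apply_prime (a b : ArithmeticFunction ℝ) {p : ℕ} (hp : p.Prime) :
    (a * b) p = a 1 * b p + a p * b 1 := by
  have := mul_apply_prime_pow a b hp 1
  simpa [Finset.Nat.antidiagonal_succ] using this

lemma pow_apply_one {a : ArithmeticFunction ℝ} (ha : a 1 = 1) (k : ℕ) : (a ^ k) 1 = 1 := by
  induction k with
  | zero => simp
  | succ k ih => simp [pow_succ, ArithmeticFunction.mul_apply, ih, ha]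

lemma pow_apply_prime {a : ArithmeticFunction ℝ} (ha : a 1 = 1) {p : ℕ} (hp : p.Prime) (k : ℕ) :
    (a ^ k) p = k * a p := by
  induction k with
  | zero => simp [hp.one_lt.ne']
  | succ k ih =>
    rw [pow_succ, mul_apply_prime _ _ hp, ih, pow_apply_one ha, ha]
    push_cast
    ring

/-- Multiplicativity of the local factors `∑_j a(p^j)/p^j` under Dirichlet convolution. -/
lemma tsum_mul_prime_pow {a b : ArithmeticFunction ℝ} {p : ℕ} (hp : p.Prime)
    (ha : Summable fun j : ℕ ↦ ‖a (p ^ j) / (p : ℝ) ^ j‖)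
    (hb : Summable fun j : ℕ ↦ ‖b (p ^ j) / (p : ℝ) ^ j‖) :
    (Summable fun j : ℕ ↦ ‖(a * b) (p ^ j) / (p : ℝ) ^ j‖) ∧
      ∑' j : ℕ, (a * b) (p ^ j) / (p : ℝ) ^ j =
        (∑' j : ℕ, a (p ^ j) / (p : ℝ) ^ j) * ∑' j : ℕ, b (p ^ j) / (p : ℝ) ^ j := by
  have e : ∀ j : ℕ, (a * b) (p ^ j) / (p : ℝ) ^ j =
      ∑ x ∈ antidiagonal j, a (p ^ x.1) / (p : ℝ) ^ x.1 * (b (p ^ x.2) / (p : ℝ) ^ x.2) := by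
    intro j
    rw [mul_apply_prime_pow a b hp, Finset.sum_div]
    refine Finset.sum_congr rfl fun x hx ↦ ?_
    rw [← mem_antidiagonal.1 hx, pow_add, mul_div_mul_comm]
  simp only [e]
  exact ⟨summable_norm_sum_mul_antidiagonal_of_summable_norm
      (f := fun j ↦ a (p ^ j) / (p : ℝ) ^ j) (g := fun j ↦ b (p ^ j) / (p : ℝ) ^ j) ha hb,
    (tsum_mul_tsum_eq_tsum_sum_antidiagonal_of_summable_norm
      (f := fun j ↦ a (p ^ j) / (p : ℝ) ^ j) (g := fun j ↦ b (p ^ j) / (p : ℝ) ^ j) ha hb).symm⟩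

lemma tsum_moebius_prime_pow {p : ℕ} (hp : p.Prime) :
    (Summable fun j : ℕ ↦ ‖(μ : ArithmeticFunction ℝ) (p ^ j) / (p : ℝ) ^ j‖) ∧
      ∑' j : ℕ, (μ : ArithmeticFunction ℝ) (p ^ j) / (p : ℝ) ^ j = 1 - 1 / (p : ℝ) := by
  have h0 : ∀ j ∉ range 2, (μ : ArithmeticFunction ℝ) (p ^ j) / (p : ℝ) ^ j = 0 := by
    intro j hj
    rw [mem_range, not_lt] at hj
    rw [ArithmeticFunction.intCoe_apply,
      ArithmeticFunction.moebius_apply_prime_pow hp (by lia), if_neg (by lia)]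
    simp
  constructor
  · exact summable_of_ne_finset_zero (s := range 2) fun j hj ↦ by rw [h0 j hj, norm_zero]
  · rw [tsum_eq_sum h0, Finset.sum_range_succ, Finset.sum_range_one]
    simp [ArithmeticFunction.intCoe_apply, ArithmeticFunction.moebius_apply_prime hp]
    ring

lemma tsum_mul_moebius_pow_prime_pow {a : ArithmeticFunction ℝ} {p : ℕ} (hp : p.Prime)
    (ha : Summable fun j : ℕ ↦ ‖a (p ^ j) / (p : ℝ) ^ j‖) (k : ℕ) :
    (Summable fun j : ℕ ↦ ‖(a * (μ : ArithmeticFunction ℝ) ^ k) (p ^ j) / (p : ℝ) ^ j‖) ∧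
      ∑' j : ℕ, (a * (μ : ArithmeticFunction ℝ) ^ k) (p ^ j) / (p : ℝ) ^ j =
        (1 - 1 / (p : ℝ)) ^ k * ∑' j : ℕ, a (p ^ j) / (p : ℝ) ^ j := by
  induction k with
  | zero => simpa using ha
  | succ k ih =>
    have h := tsum_mul_prime_pow hp ih.1 (tsum_moebius_prime_pow hp).1
    rw [mul_assoc, ← pow_succ, ih.2, (tsum_moebius_prime_pow hp).2] at h
    refine ⟨h.1, h.2.trans ?_⟩
    ring

lemma summable_add_one_pow_div_prime_pow {p : ℕ} (hp : p.Prime) (A : ℕ) :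
    Summable fun j : ℕ ↦ ((j : ℝ) + 1) ^ A / (p : ℝ) ^ j := by
  have hp2 : (2 : ℝ) ≤ p := by exact_mod_cast hp.two_le
  have hp0 : (0 : ℝ) < p := by linarith
  have h := summable_pow_mul_geometric_of_norm_lt_one A (r := (p : ℝ)⁻¹)
    (by rw [norm_inv, Real.norm_of_nonneg hp0.le]; exact inv_lt_one_of_one_lt₀ (by linarith))
  refine (((summable_nat_add_iff 1).2 h).mul_left (p : ℝ)).congr fun j ↦ ?_
  push_cast
  rw [inv_pow, pow_succ (p : ℝ) j]
  field_simp

/-- A sequence `h` on prime powers which vanishes at primes and grows at most polynomially in the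
exponent, relative to `p^j`, has local factors `1 + O(p⁻²)`, uniformly in `p`. -/
lemma exists_abs_tsum_prime_pow_sub_one_le (A : ℕ) : ∃ C : ℝ, 0 ≤ C ∧
    ∀ (h : ℕ → ℝ) (p : ℕ), p.Prime → h 1 = 1 → h p = 0 →
      (∀ j : ℕ, |h (p ^ j)| ≤ ((j : ℝ) + 1) ^ A / (p : ℝ) ^ j) →
      |∑' j : ℕ, h (p ^ j) - 1| ≤ C / (p : ℝ) ^ 2 := by
  have hs : Summable fun j : ℕ ↦ (((j + 2 : ℕ) : ℝ) + 1) ^ A / ((2 : ℕ) : ℝ) ^ j := by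
    have := (summable_nat_add_iff 2).2 (summable_add_one_pow_div_prime_pow Nat.prime_two A)
    refine (this.mul_left 4).congr fun j ↦ ?_
    rw [pow_add]
    push_cast
    field_simp
    ring
  refine ⟨∑' j : ℕ, (((j + 2 : ℕ) : ℝ) + 1) ^ A / ((2 : ℕ) : ℝ) ^ j,
    tsum_nonneg fun j ↦ by positivity, fun h p hp h1 h2 hb ↦ ?_⟩
  have hp2 : (2 : ℝ) ≤ p := by exact_mod_cast hp.two_le
  have hp0 : (0 : ℝ) < p := by linarith
  have hsum : Summable fun j : ℕ ↦ h (p ^ j) :=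
    .of_norm_bounded (summable_add_one_pow_div_prime_pow hp A) hb
  have e : ∑' j : ℕ, h (p ^ j) - 1 = ∑' j : ℕ, h (p ^ (j + 2)) := by
    rw [← hsum.sum_add_tsum_nat_add 2, Finset.sum_range_succ, Finset.sum_range_one]
    simp [h1, h2]
  rw [e, ← tsum_div_const, ← Real.norm_eq_abs]
  refine tsum_of_norm_bounded (hs.div_const _).hasSum fun j ↦ (hb (j + 2)).trans ?_
  rw [pow_add (p : ℝ), ← div_div]
  gcongr
  exact_mod_cast hp2

lemma summable_prime_div_sq (C : ℝ) : Summable fun p : Nat.Primes ↦ C / ((p : ℕ) : ℝ) ^ 2 := by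
  have h : Summable fun n : ℕ ↦ C * ((n : ℝ) ^ 2)⁻¹ :=
    (Real.summable_nat_pow_inv.2 one_lt_two).mul_left C
  exact (h.comp_injective Nat.Primes.coe_nat_injective).congr fun p ↦ by simp [div_eq_mul_inv]

/-- A nonnegative multiplicative function is summable if its local factors are `1 + O(p⁻²)`. -/
lemma summable_of_tsum_prime_pow_le {h : ℕ → ℝ} (hnn : ∀ n, 0 ≤ h n) (h0 : h 0 = 0) (h1 : h 1 = 1)
    (hmul : ∀ {m n : ℕ}, m.Coprime n → h (m * n) = h m * h n)
    (hs : ∀ {p : ℕ}, p.Prime → Summable fun j : ℕ ↦ h (p ^ j)) {C : ℝ} (hC : 0 ≤ C)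
    (hle : ∀ {p : ℕ}, p.Prime → ∑' j : ℕ, h (p ^ j) ≤ 1 + C / (p : ℝ) ^ 2) : Summable h := by
  have hsum : Summable fun n : ℕ ↦ C / (n : ℝ) ^ 2 := by
    simpa [div_eq_mul_inv] using (Real.summable_nat_pow_inv.2 one_lt_two).mul_left C
  refine summable_of_sum_range_le (c := Real.exp (∑' n : ℕ, C / (n : ℝ) ^ 2)) hnn fun N ↦ ?_
  obtain ⟨hsm, hsm'⟩ := EulerProduct.summable_and_hasSum_smoothNumbers_prod_primesBelow_tsum h1 hmul
    (fun hp ↦ by simpa only [Real.norm_of_nonneg (hnn _)] using hs hp) N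
  calc ∑ n ∈ range N, h n ≤ ∑' m : N.smoothNumbers, h m := by
        have hind : Summable ((N.smoothNumbers : Set ℕ).indicator h) :=
          summable_subtype_iff_indicator.1 hsm'.summable
        rw [_root_.tsum_subtype]
        refine le_trans (Finset.sum_le_sum fun n hn ↦ ?_)
          (hind.sum_le_tsum (range N) fun n _ ↦ Set.indicator_nonneg (fun _ _ ↦ hnn _) _)
        rcases Nat.eq_zero_or_pos n with rfl | hn0
        · rw [h0]
          exact Set.indicator_nonneg (fun _ _ ↦ hnn _) _
        · rw [Set.indicator_of_mem (Nat.mem_smoothNumbers_of_lt hn0 (mem_range.1 hn))]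
    _ = ∏ p ∈ N.primesBelow, ∑' j : ℕ, h (p ^ j) := hsm'.tsum_eq
    _ ≤ ∏ p ∈ N.primesBelow, (1 + C / (p : ℝ) ^ 2) :=
        Finset.prod_le_prod (fun p _ ↦ tsum_nonneg fun j ↦ hnn _)
          fun p hp ↦ hle (Nat.prime_of_mem_primesBelow hp)
    _ ≤ Real.exp (∑ p ∈ N.primesBelow, C / (p : ℝ) ^ 2) :=
        Real.prod_one_add_le_exp_sum _ fun p ↦ by positivity
    _ ≤ _ := Real.exp_le_exp.2 (hsum.sum_le_tsum _ fun p _ ↦ by positivity)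

/-- `τ_r τ_{r+1}` as an arithmetic function. -/
noncomputable def tauRProd (r : ℕ) : ArithmeticFunction ℝ :=
  ((ζ : ArithmeticFunction ℝ) ^ r).pmul ((ζ : ArithmeticFunction ℝ) ^ (r + 1))

lemma tauRProd_apply (r n : ℕ) : tauRProd r n = tauR r n * tauR (r + 1) n := by
  simp [tauRProd, natCast_tauR]

/-- The quotient of `τ_r τ_{r+1}` by `τ_{r²+r}` with respect to Dirichlet convolution. -/
noncomputable def tauRQuot (r : ℕ) : ArithmeticFunction ℝ :=
  tauRProd r * (μ : ArithmeticFunction ℝ) ^ (r ^ 2 + r)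

lemma tauRQuot_mul_zeta_pow (r : ℕ) :
    tauRQuot r * (ζ : ArithmeticFunction ℝ) ^ (r ^ 2 + r) = tauRProd r := by
  rw [tauRQuot, mul_assoc, ← mul_pow, ArithmeticFunction.coe_moebius_mul_coe_zeta, one_pow, mul_one]

lemma isMultiplicative_tauRQuot (r : ℕ) : (tauRQuot r).IsMultiplicative :=
  .mul (.pmul (.pow (.natCast ArithmeticFunction.isMultiplicative_zeta))
    (.pow (.natCast ArithmeticFunction.isMultiplicative_zeta)))
    (.pow (.intCast ArithmeticFunction.isMultiplicative_moebius))

lemma abs_zeta_pow_prime_pow_le {p : ℕ} (hp : p.Prime) (k j : ℕ) :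
    |((ζ : ArithmeticFunction ℝ) ^ k) (p ^ j)| ≤ ((j : ℝ) + 1) ^ k :=
  abs_pow_apply_prime_pow_le hp (fun j ↦ by simp [hp.ne_zero]) k j

lemma abs_tauRProd_prime_pow_le (r : ℕ) {p : ℕ} (hp : p.Prime) (j : ℕ) :
    |tauRProd r (p ^ j)| ≤ ((j : ℝ) + 1) ^ (r + (r + 1)) := by
  rw [tauRProd, ArithmeticFunction.pmul_apply, abs_mul,
    pow_add _ r (r + 1)]
  exact mul_le_mul (abs_zeta_pow_prime_pow_le hp _ _) (abs_zeta_pow_prime_pow_le hp _ _)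
    (abs_nonneg _) (by positivity)

lemma abs_tauRQuot_prime_pow_le (r : ℕ) {p : ℕ} (hp : p.Prime) (j : ℕ) :
    |tauRQuot r (p ^ j)| ≤ ((j : ℝ) + 1) ^ (r + (r + 1) + (r ^ 2 + r) + 1) := by
  refine abs_mul_apply_prime_pow_le hp (abs_tauRProd_prime_pow_le r hp)
    (abs_pow_apply_prime_pow_le hp (fun j ↦ ?_) _) j
  rw [ArithmeticFunction.intCoe_apply]
  exact_mod_cast ArithmeticFunction.abs_moebius_le_one

lemma tauRQuot_apply_prime (r : ℕ) {p : ℕ} (hp : p.Prime) : tauRQuot r p = 0 := by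
  have hz : (ζ : ArithmeticFunction ℝ) 1 = 1 := by simp
  have hm : (μ : ArithmeticFunction ℝ) 1 = 1 := by simp
  rw [tauRQuot, mul_apply_prime _ _ hp, pow_apply_one hm, pow_apply_prime hm hp, tauRProd,
    ArithmeticFunction.pmul_apply, ArithmeticFunction.pmul_apply, pow_apply_one hz,
    pow_apply_one hz, pow_apply_prime hz hp, pow_apply_prime hz hp]
  simp [ArithmeticFunction.intCoe_apply, ArithmeticFunction.moebius_apply_prime hp, hp.ne_zero]
  ring

lemma abs_tauRQuot_div_prime_pow_le (r : ℕ) {p : ℕ} (hp : p.Prime) (j : ℕ) :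
    |tauRQuot r (p ^ j) / ((p ^ j : ℕ) : ℝ)| ≤
      ((j : ℝ) + 1) ^ (r + (r + 1) + (r ^ 2 + r) + 1) / (p : ℝ) ^ j := by
  rw [Nat.cast_pow, abs_div, abs_of_nonneg (by positivity : (0 : ℝ) ≤ (p : ℝ) ^ j)]
  gcongr
  exact abs_tauRQuot_prime_pow_le r hp j

lemma tauRQuot_div_mul (r : ℕ) {m n : ℕ} (h : m.Coprime n) :
    tauRQuot r (m * n) / ((m * n : ℕ) : ℝ) = tauRQuot r m / m * (tauRQuot r n / n) := by
  rw [(isMultiplicative_tauRQuot r).map_mul_of_coprime h, Nat.cast_mul, mul_div_mul_comm]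

lemma summable_abs_tauRQuot_div (r : ℕ) : Summable fun n : ℕ ↦ |tauRQuot r n / n| := by
  obtain ⟨C, hC, hle⟩ := exists_abs_tsum_prime_pow_sub_one_le (r + (r + 1) + (r ^ 2 + r) + 1)
  refine summable_of_tsum_prime_pow_le (fun n ↦ abs_nonneg _) (by simp)
    (by simp [(isMultiplicative_tauRQuot r).map_one])
    (fun h ↦ by rw [tauRQuot_div_mul r h, abs_mul]) (fun hp ↦ ?_) hC (fun {p} hp ↦ ?_)
  · exact .of_nonneg_of_le (fun _ ↦ abs_nonneg _) (abs_tauRQuot_div_prime_pow_le r hp)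
      (summable_add_one_pow_div_prime_pow hp _)
  · have := hle (fun n ↦ |tauRQuot r n / n|) p hp
      (by simp [(isMultiplicative_tauRQuot r).map_one]) (by simp [tauRQuot_apply_prime r hp])
      (fun j ↦ by rw [abs_abs]; exact abs_tauRQuot_div_prime_pow_le r hp j)
    linarith [(abs_le.1 this).2]

lemma tsum_tauRQuot_prime_pow (r : ℕ) {p : ℕ} (hp : p.Prime) :
    ∑' j : ℕ, tauRQuot r (p ^ j) / ((p ^ j : ℕ) : ℝ) =
      (1 - 1 / (p : ℝ)) ^ (r ^ 2 + r) *
        ∑' j : ℕ, ((tauR r (p ^ j) : ℝ) * tauR (r + 1) (p ^ j)) / (p : ℝ) ^ j := by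
  have hs : Summable fun j : ℕ ↦ ‖tauRProd r (p ^ j) / (p : ℝ) ^ j‖ := by
    refine .of_nonneg_of_le (fun _ ↦ norm_nonneg _) (fun j ↦ ?_)
      (summable_add_one_pow_div_prime_pow hp (r + (r + 1)))
    rw [norm_div, Real.norm_of_nonneg (by positivity : (0 : ℝ) ≤ (p : ℝ) ^ j)]
    gcongr
    exact abs_tauRProd_prime_pow_le r hp j
  simpa only [Nat.cast_pow, tauRProd_apply, tauRQuot] using
    (tsum_mul_moebius_pow_prime_pow hp hs (r ^ 2 + r)).2

lemma tsum_tauRQuot (r : ℕ) : ∑' n : ℕ, tauRQuot r n / n = constC0 r := by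
  have h := EulerProduct.eulerProduct_hasProd (f := fun n : ℕ ↦ tauRQuot r n / n)
    (by simp [(isMultiplicative_tauRQuot r).map_one]) (tauRQuot_div_mul r)
    (summable_abs_tauRQuot_div r) (by simp)
  rw [← h.tprod_eq, constC0]
  exact tprod_congr fun p ↦ tsum_tauRQuot_prime_pow r p.2

lemma tsum_tauRQuot_prime_pow_ne_zero (r : ℕ) {p : ℕ} (hp : p.Prime) :
    ∑' j : ℕ, tauRQuot r (p ^ j) / ((p ^ j : ℕ) : ℝ) ≠ 0 := by
  rw [tsum_tauRQuot_prime_pow r hp]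
  have hp2 : (1 : ℝ) < p := by exact_mod_cast hp.one_lt
  have h1 : 1 / (p : ℝ) < 1 := by rw [div_lt_one (by linarith)]; exact hp2
  have hs : Summable fun j : ℕ ↦
      ((tauR r (p ^ j) : ℝ) * tauR (r + 1) (p ^ j)) / (p : ℝ) ^ j := by
    refine .of_nonneg_of_le (fun _ ↦ by positivity) (fun j ↦ ?_)
      (summable_add_one_pow_div_prime_pow hp (r + (r + 1)))
    rw [← tauRProd_apply]
    gcongr
    exact (le_abs_self _).trans (abs_tauRProd_prime_pow_le r hp j)
  have hz : (ζ : ArithmeticFunction ℝ) 1 = 1 := by simp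
  refine mul_ne_zero (pow_ne_zero _ (by linarith)) (hs.tsum_pos (fun _ ↦ by positivity) 0 ?_).ne'
  simp [natCast_tauR, pow_apply_one hz]

lemma constC0_ne_zero (r : ℕ) : constC0 r ≠ 0 := by
  obtain ⟨C, hC, hle⟩ := exists_abs_tsum_prime_pow_sub_one_le (r + (r + 1) + (r ^ 2 + r) + 1)
  have h := tprod_one_add_ne_zero_of_summable
    (f := fun p : Nat.Primes ↦ ∑' j : ℕ, tauRQuot r (p ^ j) / (((p : ℕ) ^ j : ℕ) : ℝ) - 1)
    (fun p ↦ by rw [add_sub_cancel]; exact tsum_tauRQuot_prime_pow_ne_zero r p.2)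
    (.of_nonneg_of_le (fun _ ↦ norm_nonneg _) (fun p ↦ hle (fun n ↦ tauRQuot r n / n) p p.2
      (by simp [(isMultiplicative_tauRQuot r).map_one]) (by simp [tauRQuot_apply_prime r p.2])
      (abs_tauRQuot_div_prime_pow_le r p.2)) (summable_prime_div_sq C))
  simp only [add_sub_cancel] at h
  rwa [tprod_congr fun p : Nat.Primes ↦ tsum_tauRQuot_prime_pow r p.2] at h

lemma sum_tauR_eq_reciprocalSum (r M : ℕ) :
    ∑ n ∈ Icc 1 M, ∑ u ∈ Icc 1 (M / n), (tauR r u : ℝ) * tauR r (n * u) / (n * u) =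
      reciprocalSum (tauRProd r) M := by
  rw [sum_Icc_sum_Icc_div fun n u ↦ (tauR r u : ℝ) * tauR r (n * u) / (n * u), reciprocalSum,
    Nat.floor_natCast]
  refine Finset.sum_congr rfl fun m _ ↦ ?_
  rw [tauRProd_apply, tauR_succ_apply, Nat.cast_sum, Finset.mul_sum, Finset.sum_div]
  refine Finset.sum_congr rfl fun x hx ↦ ?_
  rw [← Nat.cast_mul x.1, (Nat.mem_divisorsAntidiagonal.1 hx).1, mul_comm]

/-- Fix `r ∈ ℕ`. Then
`Σ_{nu ≤ M} τ_r(u) τ_r(nu)/(nu) = (C₀ (log M)^{r²+r}/(r²+r)!) (1 + o(1))` as `M → ∞`. -/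
theorem sum_tauR_quadratic_form (r : ℕ) (hr : 1 ≤ r) :
    (fun M : ℕ =>
        (∑ n ∈ Finset.Icc 1 M, ∑ u ∈ Finset.Icc 1 (M / n),
          (tauR r u : ℝ) * tauR r (n * u) / (n * u)) -
          constC0 r * Real.log M ^ (r ^ 2 + r) / (r ^ 2 + r).factorial)
      =o[atTop] fun M : ℕ =>
        constC0 r * Real.log M ^ (r ^ 2 + r) / (r ^ 2 + r).factorial := by
  obtain ⟨k, hk⟩ : ∃ k, r ^ 2 + r = k + 1 := Nat.exists_eq_succ_of_ne_zero (by positivity)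
  have h := tendsto_reciprocalSum_mul_zeta_pow (summable_abs_tauRQuot_div r) k
  rw [← hk, tauRQuot_mul_zeta_pow, tsum_tauRQuot] at h
  have hlog : ∀ᶠ M : ℕ in atTop, 0 < Real.log M :=
    (Real.tendsto_log_atTop.comp tendsto_natCast_atTop_atTop).eventually_gt_atTop 0
  have hC := constC0_ne_zero r
  have hfac : ((r ^ 2 + r).factorial : ℝ) ≠ 0 := by exact_mod_cast Nat.factorial_ne_zero _
  refine Asymptotics.IsEquivalent.isLittleO ((Asymptotics.isEquivalent_iff_tendsto_one ?_).2 ?_)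
  · filter_upwards [hlog] with M hM
    exact div_ne_zero (mul_ne_zero hC (pow_pos hM _).ne') hfac
  · have h' := h.div_const (constC0 r * (1 / (r ^ 2 + r).factorial))
    rw [div_self (mul_ne_zero hC (one_div_ne_zero hfac))] at h'
    refine h'.congr fun M ↦ ?_
    simp only [Pi.div_apply, sum_tauR_eq_reciprocalSum]
    field_simp
end
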